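/- Let V ⊆ [0,1] be finite with {0,1} ⊆ V. For every BQCTL*[F] state formula ∃p.φ', every (AP,V)-labelled D-tree t and every node u of t, the supremum defining ⟦∃p.φ'⟧_t(u) is attained: there exists a tree t' ≡_p t such that ⟦φ'⟧_{t'}(u) = ⟦∃p.φ'⟧_t(u); consequently ⟦∃p.φ'⟧_t(u) ∈ V(φ'), the set of satisfaction values of φ' over (AP,V)-labelled D-trees. -/

import Mathlib

open scoped Classical

mutual
inductive StateF (AP : Type) : Type where
  | atom : AP → StateF AP
  | app : (n : ℕ) → ((Fin n → ℝ) → ℝ) → (Fin n → StateF AP) → StateF AP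
  | ex : AP → StateF AP → StateF AP
  | E : PathF AP → StateF AP

inductive PathF (AP : Type) : Type where
  | state : StateF AP → PathF AP
  | next : PathF AP → PathF AP
  | until_ : PathF AP → PathF AP → PathF AP
  | app : (n : ℕ) → ((Fin n → ℝ) → ℝ) → (Fin n → PathF AP) → PathF AP
end

variable {AP D : Type}

mutual
def ssize : StateF AP → ℕ
  | .atom _ => 1
  | .app n _ args => 1 + Finset.univ.sum (fun i : Fin n => ssize (args i))
  | .ex _ φ => 1 + ssize φ
  | .E ψ => 1 + psize ψ
def psize : PathF AP → ℕ
  | .state φ => ssize φ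
  | .next ψ => 1 + psize ψ
  | .until_ ψ₁ ψ₂ => 1 + psize ψ₁ + psize ψ₂
  | .app n _ args => 1 + Finset.univ.sum (fun i : Fin n => psize (args i))
end

structure LTree (D L : Type) where
  dom : Set (List D)
  label : List D → L

def IsTree (t : LTree D L) : Prop :=
  ([] ∈ t.dom) ∧ (∀ u ∈ t.dom, ∀ v : List D, v <+: u → v ∈ t.dom) ∧
    (∀ u ∈ t.dom, ∃ d : D, u ++ [d] ∈ t.dom)

def Labelled (t : LTree D (AP → ℝ)) (V : Set ℝ) : Prop :=
  ∀ u ∈ t.dom, ∀ p, t.label u p ∈ V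

def IsBranch (t : LTree D L) (u : List D) (lam : ℕ → List D) : Prop :=
  lam 0 = u ∧ ∀ i, lam i ∈ t.dom ∧ ∃ d : D, lam (i + 1) = lam i ++ [d]

def PropEquiv (p : AP) (t t' : LTree D (AP → ℝ)) : Prop :=
  t'.dom = t.dom ∧
    ∀ u ∈ t.dom, (∀ q, q ≠ p → t'.label u q = t.label u q) ∧
      (t'.label u p = 0 ∨ t'.label u p = 1)

mutual
noncomputable def ssem : StateF AP → LTree D (AP → ℝ) → List D → ℝ
  | .atom p, t, u => t.label u p
  | .app n f args, t, u => f fun i => ssem (args i) t u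
  | .ex p φ, t, u => sSup {v | ∃ t', PropEquiv p t t' ∧ ssem φ t' u = v}
  | .E ψ, t, u => sSup {v | ∃ lam, IsBranch t u lam ∧ psem ψ t lam = v}
noncomputable def psem : PathF AP → LTree D (AP → ℝ) → (ℕ → List D) → ℝ
  | .state φ, t, lam => ssem φ t (lam 0)
  | .next ψ, t, lam => psem ψ t fun k => lam (1 + k)
  | .until_ ψ₁ ψ₂, t, lam =>
      sSup {v | ∃ i : ℕ,
        v = min (psem ψ₂ t fun k => lam (i + k))
          (sInf ({w | ∃ j < i, psem ψ₁ t (fun k => lam (j + k)) = w} ∪ {1}))}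
  | .app n f args, t, lam => f fun i => psem (args i) t lam
end

def ValS (D : Type) (V : Set ℝ) (φ : StateF AP) : Set ℝ :=
  {v | ∃ t : LTree D (AP → ℝ), ∃ u : List D,
    IsTree t ∧ Labelled t V ∧ u ∈ t.dom ∧ ssem φ t u = v}

def ValP (D : Type) (V : Set ℝ) (ψ : PathF AP) : Set ℝ :=
  {v | ∃ t : LTree D (AP → ℝ), ∃ u : List D, ∃ lam : ℕ → List D,
    IsTree t ∧ Labelled t V ∧ u ∈ t.dom ∧ IsBranch t u lam ∧ psem ψ t lam = v}

theorem sSup_mem_insert_zero {S F : Set ℝ} (hF : F.Finite) (hS : S ⊆ F) :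
    sSup S ∈ insert 0 F := by
  rcases S.eq_empty_or_nonempty with rfl | hne
  · simp
  · exact Or.inr (hS (hne.csSup_mem (hF.subset hS)))

theorem PropEquiv.labelled {V : Set ℝ} (h0 : (0 : ℝ) ∈ V) (h1 : (1 : ℝ) ∈ V) {p : AP}
    {t t' : LTree D (AP → ℝ)} (h : PropEquiv p t t') (hlab : Labelled t V) :
    Labelled t' V := by
  intro u hu q
  rw [h.1] at hu
  by_cases hq : q = p
  · subst hq
    rcases (h.2 u hu).2 with h' | h' <;> rw [h'] <;> assumption
  · rw [(h.2 u hu).1 q hq]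
    exact hlab u hu q

theorem IsTree.of_dom_eq {L L' : Type} {t : LTree D L} {t' : LTree D L'} (ht : IsTree t)
    (h : t'.dom = t.dom) : IsTree t' := by
  unfold IsTree at *
  rwa [h]

theorem exists_propEquiv (p : AP) (t : LTree D (AP → ℝ)) : ∃ t', PropEquiv p t t' :=
  ⟨⟨t.dom, fun u => Function.update (t.label u) p 0⟩, rfl, fun _ _ =>
    ⟨fun _ hq => Function.update_of_ne hq _ _, Or.inl (by simp)⟩⟩

mutual
/-- The values of a state formula over trees labelled in a finite set `V` containing `0` and `1`
range over a finite set. -/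
theorem exists_finite_ssem_mem {V : Set ℝ} (hV : V.Finite) (h0 : (0 : ℝ) ∈ V)
    (h1 : (1 : ℝ) ∈ V) : ∀ φ : StateF AP, ∃ F : Set ℝ, F.Finite ∧
      ∀ (t : LTree D (AP → ℝ)) (u : List D), Labelled t V → u ∈ t.dom → ssem φ t u ∈ F
  | .atom p => ⟨V, hV, fun t u hl hu => by rw [ssem]; exact hl u hu p⟩
  | .app n f args => by
    choose F hF hmem using fun i => exists_finite_ssem_mem hV h0 h1 (args i)
    refine ⟨f '' Set.univ.pi F, (Set.Finite.pi' hF).image f |>.subset ?_, ?_⟩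
    · exact Set.image_mono fun x hx i => hx i trivial
    · intro t u hl hu
      rw [ssem]
      exact ⟨_, fun i _ => hmem i t u hl hu, rfl⟩
  | .ex p φ => by
    obtain ⟨F, hF, hmem⟩ := exists_finite_ssem_mem hV h0 h1 φ
    refine ⟨insert 0 F, hF.insert 0, fun t u hl hu => ?_⟩
    rw [ssem]
    refine sSup_mem_insert_zero hF ?_
    rintro _ ⟨t', ht', rfl⟩
    exact hmem t' u (ht'.labelled h0 h1 hl) (ht'.1 ▸ hu)
  | .E ψ => by
    obtain ⟨F, hF, hmem⟩ := exists_finite_psem_mem hV h0 h1 ψ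
    refine ⟨insert 0 F, hF.insert 0, fun t u hl hu => ?_⟩
    rw [ssem]
    refine sSup_mem_insert_zero hF ?_
    rintro _ ⟨lam, hlam, rfl⟩
    exact hmem t lam hl fun i => (hlam.2 i).1

/-- The values of a path formula over trees labelled in a finite set `V` containing `0` and `1`
range over a finite set. -/
theorem exists_finite_psem_mem {V : Set ℝ} (hV : V.Finite) (h0 : (0 : ℝ) ∈ V)
    (h1 : (1 : ℝ) ∈ V) : ∀ ψ : PathF AP, ∃ F : Set ℝ, F.Finite ∧
      ∀ (t : LTree D (AP → ℝ)) (lam : ℕ → List D), Labelled t V → (∀ i, lam i ∈ t.dom) →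
        psem ψ t lam ∈ F
  | .state φ => by
    obtain ⟨F, hF, hmem⟩ := exists_finite_ssem_mem hV h0 h1 φ
    refine ⟨F, hF, fun t lam hl hlam => ?_⟩
    rw [psem]
    exact hmem t _ hl (hlam 0)
  | .next ψ => by
    obtain ⟨F, hF, hmem⟩ := exists_finite_psem_mem hV h0 h1 ψ
    refine ⟨F, hF, fun t lam hl hlam => ?_⟩
    rw [psem]
    exact hmem t _ hl fun i => hlam _
  | .until_ ψ₁ ψ₂ => by
    obtain ⟨F₁, hF₁, hmem₁⟩ := exists_finite_psem_mem hV h0 h1 ψ₁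
    obtain ⟨F₂, hF₂, hmem₂⟩ := exists_finite_psem_mem hV h0 h1 ψ₂
    have hF : (F₂ ∪ (F₁ ∪ {1})).Finite := hF₂.union (hF₁.union (Set.finite_singleton 1))
    refine ⟨insert 0 (F₂ ∪ (F₁ ∪ {1})), hF.insert 0, fun t lam hl hlam => ?_⟩
    rw [psem]
    refine sSup_mem_insert_zero hF ?_
    rintro _ ⟨i, rfl⟩
    have hsub : {w | ∃ j < i, psem ψ₁ t (fun k => lam (j + k)) = w} ∪ {1} ⊆ F₁ ∪ {1} := by
      refine Set.union_subset_union_left _ ?_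
      rintro _ ⟨j, -, rfl⟩
      exact hmem₁ t _ hl fun k => hlam _
    have hinf := hsub (Set.Nonempty.csInf_mem ⟨1, Or.inr rfl⟩
      ((hF₁.union (Set.finite_singleton 1)).subset hsub))
    rcases min_choice (psem ψ₂ t fun k => lam (i + k))
      (sInf ({w | ∃ j < i, psem ψ₁ t (fun k => lam (j + k)) = w} ∪ {1})) with h | h <;> rw [h]
    · exact Or.inl (hmem₂ t _ hl fun k => hlam _)
    · exact Or.inr hinf
  | .app n f args => by
    choose F hF hmem using fun i => exists_finite_psem_mem hV h0 h1 (args i)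
    refine ⟨f '' Set.univ.pi F, (Set.Finite.pi' hF).image f |>.subset ?_, ?_⟩
    · exact Set.image_mono fun x hx i => hx i trivial
    · intro t lam hl hlam
      rw [psem]
      exact ⟨_, fun i _ => hmem i t lam hl hlam, rfl⟩
end

/-- The supremum defining `⟦∃p.φ'⟧_t(u)` is attained: there is a
`p`-equivalent tree `t'` realizing it; consequently the value belongs to `V(φ')`. -/
theorem stmt3 {AP D : Type} [Fintype AP] [Fintype D] [Nonempty D]
    (V : Set ℝ) (hVfin : V.Finite) (hVsub : V ⊆ Set.Icc (0 : ℝ) 1)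
    (h0 : (0 : ℝ) ∈ V) (h1 : (1 : ℝ) ∈ V)
    (p : AP) (φ' : StateF AP)
    (t : LTree D (AP → ℝ)) (ht : IsTree t) (hlab : Labelled t V)
    (u : List D) (hu : u ∈ t.dom) :
    (∃ t' : LTree D (AP → ℝ), PropEquiv p t t' ∧
        ssem φ' t' u = ssem (StateF.ex p φ') t u) ∧
      ssem (StateF.ex p φ') t u ∈ ValS D V φ' := by
  obtain ⟨F, hF, hmem⟩ := exists_finite_ssem_mem (D := D) hVfin h0 h1 φ'
  have hsub : {v | ∃ t', PropEquiv p t t' ∧ ssem φ' t' u = v} ⊆ F := by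
    rintro _ ⟨t', ht', rfl⟩
    exact hmem t' u (ht'.labelled h0 h1 hlab) (ht'.1 ▸ hu)
  obtain ⟨t₀, ht₀⟩ := exists_propEquiv p t
  have hne : {v | ∃ t', PropEquiv p t t' ∧ ssem φ' t' u = v}.Nonempty := ⟨_, t₀, ht₀, rfl⟩
  obtain ⟨t', ht', hval⟩ := hne.csSup_mem (hF.subset hsub)
  rw [ssem]
  exact ⟨⟨t', ht', hval⟩, t', u, ht.of_dom_eq ht'.1, ht'.labelled h0 h1 hlab, ht'.1 ▸ hu, hval⟩
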